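/- Associativity of composition: let S1, S2, S3 be communicating systems over pairwise disjoint role sets P1, P2, P3, let H ∈ P1 and K ∈ P2 with M¹_H ↔ M²_K, and let I ∈ P2 and J ∈ P3 with I ≠ K and M²_I ↔ M³_J. Then the composed systems (S1 ⋈_{H,K} S2) ⋈_{I,J} S3 and S1 ⋈_{H,K} (S2 ⋈_{I,J} S3) are equal, i.e., they assign the same CFSM to every role p ∈ P1 ∪ P2 ∪ P3 (note that in S1 ⋈_{H,K} S2 the machine of role I is still M²_I, and in S2 ⋈_{I,J} S3 the machine of role K is still M²_K, so the required compatibilities hold for both bracketings). -/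

import Mathlib

/- Common formalization of Communicating Finite State Machines (CFSMs),
communicating systems, gateways and their composition, following
"Global Types with Internal Delegation" / GTIR paper definitions. -/

namespace GTIR

/-- Polarity of an action: `!` (send) or `?` (receive). -/
inductive Pol : Type
  | bang
  | query
deriving DecidableEq

/-- Dual polarity: swap `!` and `?`. -/
def Pol.dual : Pol → Pol
  | .bang => .query
  | .query => .bang

/-- Actions over roles `R` and messages `A`:
`snd s r a` is `sr!a` (s sends `a` to r), `rcv s r a` is `sr?a`
(r receives/consumes `a` sent by s). -/
inductive Act (R A : Type) : Type
  | snd : R → R → A → Act R A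
  | rcv : R → R → A → Act R A

/-- The action is a send action. -/
def Act.isSend {R A : Type} : Act R A → Prop
  | .snd _ _ _ => True
  | .rcv _ _ _ => False

/-- The action is a receive action. -/
def Act.isRecv {R A : Type} : Act R A → Prop
  | .snd _ _ _ => False
  | .rcv _ _ _ => True

/-- Erase the channel name of an action: `pq!a ↦ !a`, `pq?a ↦ ?a`. -/
def Act.noC {R A : Type} : Act R A → Pol × A
  | .snd _ _ a => (.bang, a)
  | .rcv _ _ a => (.query, a)

/-- The dual of a word over `{!,?} × A`: swap `!` and `?` pointwise. -/
def dualWord {A : Type} (w : List (Pol × A)) : List (Pol × A) :=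
  w.map fun x => (x.1.dual, x.2)

/-- Universal state type: base states from `B`, plus arbitrarily nested fresh
"hat" states (one for each transition) used by the gateway construction. -/
inductive St (R A B : Type) : Type
  | base : B → St R A B
  | hat : St R A B → Act R A → St R A B → St R A B

/-- A communicating finite state machine over roles `R` and messages `A`,
with states taken from `St R A B`: an initial state together with a
transition relation. -/
structure CFSM (R A B : Type) where
  init : St R A B
  delta : Set (St R A B × Act R A × St R A B)

namespace CFSM

variable {R A B : Type}

/-- A state is final if it has no outgoing transition. -/
def Final (M : CFSM R A B) (q : St R A B) : Prop :=
  ∀ l q', (q, l, q') ∉ M.delta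

/-- A sending state: non-final, and all outgoing transitions are sends. -/
def Sending (M : CFSM R A B) (q : St R A B) : Prop :=
  (∃ l q', (q, l, q') ∈ M.delta) ∧ ∀ l q', (q, l, q') ∈ M.delta → l.isSend

/-- A receiving state: non-final, and all outgoing transitions are receives. -/
def Receiving (M : CFSM R A B) (q : St R A B) : Prop :=
  (∃ l q', (q, l, q') ∈ M.delta) ∧ ∀ l q', (q, l, q') ∈ M.delta → l.isRecv

/-- A mixed state: it has both an outgoing send and an outgoing receive. -/
def Mixed (M : CFSM R A B) (q : St R A B) : Prop :=
  (∃ l q', (q, l, q') ∈ M.delta ∧ l.isSend) ∧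
  (∃ l q', (q, l, q') ∈ M.delta ∧ l.isRecv)

/-- `M` has no mixed states. -/
def NoMixed (M : CFSM R A B) : Prop := ∀ q, ¬ M.Mixed q

/-- `?`-determinism: two receives of the same message from the same state
(possibly on different channels) have the same target. -/
def QDet (M : CFSM R A B) : Prop :=
  ∀ q a s r s' r' q' q'', (q, Act.rcv s r a, q') ∈ M.delta →
    (q, Act.rcv s' r' a, q'') ∈ M.delta → q' = q''

/-- `!`-determinism: two sends of the same message from the same state
(possibly on different channels) have the same target. -/
def BDet (M : CFSM R A B) : Prop :=
  ∀ q a s r s' r' q' q'', (q, Act.snd s r a, q') ∈ M.delta →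
    (q, Act.snd s' r' a, q'') ∈ M.delta → q' = q''

/-- `?!`-determinism. -/
def IODet (M : CFSM R A B) : Prop := M.QDet ∧ M.BDet

/-- Accepting runs from a given state (every state is accepting). -/
inductive Accepts (M : CFSM R A B) : St R A B → List (Act R A) → Prop
  | nil (q : St R A B) : Accepts M q []
  | cons {q : St R A B} {l : Act R A} {q' : St R A B} {φ : List (Act R A)} :
      (q, l, q') ∈ M.delta → Accepts M q' φ → Accepts M q (l :: φ)

/-- The language of `M` over `Act`. -/
def lang (M : CFSM R A B) : Set (List (Act R A)) := {φ | M.Accepts M.init φ}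

/-- The language of `M` with channel names erased. -/
def langNoC (M : CFSM R A B) : Set (List (Pol × A)) :=
  (fun φ => φ.map Act.noC) '' M.lang

/-- Compatibility `M ↔ M'`: the channel-erased language of `M` is the set of
duals of the channel-erased language of `M'`; moreover neither machine has a
mixed state and both are `?!`-deterministic. -/
def Compat (M M' : CFSM R A B) : Prop :=
  M.langNoC = dualWord '' M'.langNoC ∧
  M.NoMixed ∧ M'.NoMixed ∧ M.IODet ∧ M'.IODet

/-- The machine of role `p` over the role set `P`: every transition label is
an action of `p` (a send `pr!a` or a receive `rp?a`) with partner `r ∈ P`. -/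
def ActsFor (M : CFSM R A B) (p : R) (P : Set R) : Prop :=
  ∀ q l q', (q, l, q') ∈ M.delta →
    ∃ r a, r ∈ P ∧ r ≠ p ∧ (l = Act.snd p r a ∨ l = Act.rcv r p a)

/-- All states occurring in `M` are base states; this guarantees that the
intermediate "hat" states of the gateway construction are fresh for `M`. -/
def HatFree (M : CFSM R A B) : Prop :=
  (∃ b, M.init = St.base b) ∧
  ∀ q l q', (q, l, q') ∈ M.delta →
    (∃ b, q = St.base b) ∧ (∃ b, q' = St.base b)

/-- The set `Q̂` of fresh intermediate gateway states of `M`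
(one for each transition of `M`). -/
def hatStates (M : CFSM R A B) : Set (St R A B) :=
  {x | ∃ q l q', (q, l, q') ∈ M.delta ∧ x = St.hat q l q'}

/-- The gateway `gw(M_H, K)` of the machine `M` of role `H` towards role `K`:
each transition `t = (q, Hs!a, q')` of `M` is replaced by
`(q, KH?a, q̂_t)` and `(q̂_t, Hs!a, q')`, and each transition
`t = (q, sH?a, q')` of `M` is replaced by `(q, sH?a, q̂_t)` and
`(q̂_t, HK!a, q')`. -/
def gw (M : CFSM R A B) (H K : R) : CFSM R A B where
  init := M.init
  delta :=
    {x | ∃ q s a q', (q, Act.snd H s a, q') ∈ M.delta ∧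
      (x = (q, Act.rcv K H a, St.hat q (Act.snd H s a) q') ∨
       x = (St.hat q (Act.snd H s a) q', Act.snd H s a, q'))} ∪
    {x | ∃ q s a q', (q, Act.rcv s H a, q') ∈ M.delta ∧
      (x = (q, Act.rcv s H a, St.hat q (Act.rcv s H a) q') ∨
       x = (St.hat q (Act.rcv s H a) q', Act.snd H K a, q'))}

end CFSM

/-- A communicating system: a set of roles together with a CFSM for each role. -/
structure CS (R A B : Type) where
  roles : Set R
  mach : R → CFSM R A B

namespace CS

variable {R A B : Type}

/-- Well-formedness: the machine of each role `p` of the system only carries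
actions of `p` with partners among the system's roles. -/
def WF (S : CS R A B) : Prop :=
  ∀ p ∈ S.roles, (S.mach p).ActsFor p S.roles

/-- Each machine of the system has a finite transition relation
(hence finitely many relevant states). -/
def FiniteSys (S : CS R A B) : Prop :=
  ∀ p ∈ S.roles, (S.mach p).delta.Finite

open scoped Classical in
/-- Composition `S1 ⋈_{H,K} S2`: the union of the two systems, where the
machines of the interface roles `H` and `K` are replaced by the gateways
`gw(M¹_H, K)` and `gw(M²_K, H)`. -/
noncomputable def compose (S1 S2 : CS R A B) (H K : R) : CS R A B where
  roles := S1.roles ∪ S2.roles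
  mach := fun p =>
    if p = H then (S1.mach H).gw H K
    else if p = K then (S2.mach K).gw K H
    else if p ∈ S1.roles then S1.mach p
    else S2.mach p

end CS

/-- A configuration: a local state for every role and a buffer (word over the
messages) for every ordered channel. -/
structure Config (R A B : Type) where
  st : R → St R A B
  buf : R → R → List A

/-- The initial configuration(s) of a system: every machine of the system is
in its initial state and all the system's buffers are empty. -/
def InitConf {R A B : Type} (S : CS R A B) (c : Config R A B) : Prop :=
  (∀ p ∈ S.roles, c.st p = (S.mach p).init) ∧
  (∀ p ∈ S.roles, ∀ q ∈ S.roles, c.buf p q = [])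

/-- One asynchronous step of system `S`, labelled by an action:
a send `sr!a` appends `a` to the buffer of channel `sr`, a receive `sr?a`
removes `a` from the front of the buffer of channel `sr`; everything else is
unchanged. -/
def Step {R A B : Type} (S : CS R A B) (c : Config R A B) :
    Act R A → Config R A B → Prop
  | .snd s r a, c' =>
      s ∈ S.roles ∧ (c.st s, Act.snd s r a, c'.st s) ∈ (S.mach s).delta ∧
      (∀ p, p ≠ s → c'.st p = c.st p) ∧
      c'.buf s r = c.buf s r ++ [a] ∧
      (∀ p q, ¬(p = s ∧ q = r) → c'.buf p q = c.buf p q)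
  | .rcv s r a, c' =>
      r ∈ S.roles ∧ (c.st r, Act.rcv s r a, c'.st r) ∈ (S.mach r).delta ∧
      (∀ p, p ≠ r → c'.st p = c.st p) ∧
      c.buf s r = a :: c'.buf s r ∧
      (∀ p q, ¬(p = s ∧ q = r) → c'.buf p q = c.buf p q)

/-- `RS(S)`: the configurations reachable from the initial configuration. -/
def Reach {R A B : Type} (S : CS R A B) (c : Config R A B) : Prop :=
  ∃ c₀, InitConf S c₀ ∧
    Relation.ReflTransGen (fun x y => ∃ l, Step S x l y) c₀ c

/-- Deadlock configuration: all the system's buffers are empty and every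
machine is in a receiving state. -/
def DeadlockConf {R A B : Type} (S : CS R A B) (c : Config R A B) : Prop :=
  (∀ p ∈ S.roles, ∀ q ∈ S.roles, c.buf p q = []) ∧
  ∀ p ∈ S.roles, (S.mach p).Receiving (c.st p)

/-- A system is deadlock-free if no reachable configuration is a deadlock. -/
def DeadlockFree {R A B : Type} (S : CS R A B) : Prop :=
  ∀ c, Reach S c → ¬ DeadlockConf S c

/-- Orphan-message configuration: every machine is in a final state but some
buffer of the system is non-empty. -/
def OrphanConf {R A B : Type} (S : CS R A B) (c : Config R A B) : Prop :=
  (∀ p ∈ S.roles, (S.mach p).Final (c.st p)) ∧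
  ∃ p ∈ S.roles, ∃ q ∈ S.roles, c.buf p q ≠ []

/-- Unspecified reception configuration: some machine is in a receiving state
but each of its expected input buffers is non-empty and starts with a message
it cannot receive. -/
def UnspecConf {R A B : Type} (S : CS R A B) (c : Config R A B) : Prop :=
  ∃ r ∈ S.roles, (S.mach r).Receiving (c.st r) ∧
    ∀ s a q', (c.st r, Act.rcv s r a, q') ∈ (S.mach r).delta →
      c.buf s r ≠ [] ∧ ∀ w, c.buf s r ≠ a :: w

/-- A system is safe if no reachable configuration is a deadlock,
an orphan-message, or an unspecified reception configuration. -/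
def Safe {R A B : Type} (S : CS R A B) : Prop :=
  ∀ c, Reach S c →
    ¬ DeadlockConf S c ∧ ¬ OrphanConf S c ∧ ¬ UnspecConf S c

end GTIR

open GTIR

/-- associativity of composition:
`(S1 ⋈_{H,K} S2) ⋈_{I,J} S3` and `S1 ⋈_{H,K} (S2 ⋈_{I,J} S3)` assign the
same CFSM to every role. -/
theorem stmt14_compose_assoc
    {R A B : Type} [Finite R] [Finite A]
    (S1 S2 S3 : CS R A B) (H K I J : R)
    (hH : H ∈ S1.roles) (hK : K ∈ S2.roles)
    (hI : I ∈ S2.roles) (hJ : J ∈ S3.roles)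
    (hIK : I ≠ K)
    (hdisj12 : S1.roles ∩ S2.roles = ∅)
    (hdisj13 : S1.roles ∩ S3.roles = ∅)
    (hdisj23 : S2.roles ∩ S3.roles = ∅)
    (hcompatHK : (S1.mach H).Compat (S2.mach K))
    (hcompatIJ : (S2.mach I).Compat (S3.mach J)) :
    CS.compose (CS.compose S1 S2 H K) S3 I J =
      CS.compose S1 (CS.compose S2 S3 I J) H K := by
  have d12 : ∀ x, x ∈ S1.roles → x ∉ S2.roles := fun x h h' => by
    have : x ∈ S1.roles ∩ S2.roles := ⟨h, h'⟩
    simp [hdisj12] at this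
  have d13 : ∀ x, x ∈ S1.roles → x ∉ S3.roles := fun x h h' => by
    have : x ∈ S1.roles ∩ S3.roles := ⟨h, h'⟩
    simp [hdisj13] at this
  have d23 : ∀ x, x ∈ S2.roles → x ∉ S3.roles := fun x h h' => by
    have : x ∈ S2.roles ∩ S3.roles := ⟨h, h'⟩
    simp [hdisj23] at this
  unfold CS.compose
  simp only [CS.mk.injEq, Set.union_assoc, Set.mem_union, true_and]
  funext p
  grind
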